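/- Let X be the conjugacy class of involutions in G_5 with labelled cycle type (1,2,0,1), i.e. n = 5, m = 1, k_e = 2, k_o = 0 and l = 1. Then the commuting involution graph C(G_5,X) is connected with diameter exactly 5. -/

import Mathlib

/-!
Common setup: the affine Weyl group of type C̃ₙ, realized as the semidirect
product of the group Wₙ of signed permutations of {1,…,n} with the translation
lattice ℤⁿ.  An element is a triple `(π, s, v)`, where `π` is the underlying
permutation of the n points, `s i` is the sign attached to the point `i`
(so the signed permutation maps the point `i` to the point `π i` with sign `s i`),
and `v ∈ ℤⁿ` is the translation part.  The multiplication realizes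
`(α,v)(τ,u) = (ατ, vᵗ + u)`.
-/

/-- An element of the affine Weyl group of type C̃ₙ: a signed permutation
`(π, s)` together with a translation vector `v ∈ ℤⁿ`. -/
@[ext]
structure AffineWeylC (n : ℕ) where
  π : Equiv.Perm (Fin n)
  s : Fin n → ℤˣ
  v : Fin n → ℤ

namespace AffineWeylC

variable {n : ℕ}

instance : One (AffineWeylC n) := ⟨⟨1, 1, 0⟩⟩

instance : Mul (AffineWeylC n) :=
  ⟨fun g h => ⟨h.π * g.π, fun j => g.s j * h.s (g.π j),
    fun i => (h.s (h.π⁻¹ i) : ℤ) * g.v (h.π⁻¹ i) + h.v i⟩⟩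

instance : Inv (AffineWeylC n) :=
  ⟨fun g => ⟨g.π⁻¹, fun k => (g.s (g.π⁻¹ k))⁻¹,
    fun i => -(((g.s i)⁻¹ : ℤˣ) : ℤ) * g.v (g.π i)⟩⟩

@[simp] lemma mul_π (g h : AffineWeylC n) : (g * h).π = h.π * g.π := rfl
@[simp] lemma mul_s (g h : AffineWeylC n) (j : Fin n) :
    (g * h).s j = g.s j * h.s (g.π j) := rfl
@[simp] lemma mul_v (g h : AffineWeylC n) (i : Fin n) :
    (g * h).v i = (h.s (h.π⁻¹ i) : ℤ) * g.v (h.π⁻¹ i) + h.v i := rfl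
@[simp] lemma one_π : (1 : AffineWeylC n).π = 1 := rfl
@[simp] lemma one_s (j : Fin n) : (1 : AffineWeylC n).s j = 1 := rfl
@[simp] lemma one_v (i : Fin n) : (1 : AffineWeylC n).v i = 0 := rfl
@[simp] lemma inv_π (g : AffineWeylC n) : g⁻¹.π = g.π⁻¹ := rfl
@[simp] lemma inv_s (g : AffineWeylC n) (k : Fin n) :
    g⁻¹.s k = (g.s (g.π⁻¹ k))⁻¹ := rfl
@[simp] lemma inv_v (g : AffineWeylC n) (i : Fin n) :
    g⁻¹.v i = -(((g.s i)⁻¹ : ℤˣ) : ℤ) * g.v (g.π i) := rfl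

instance : Group (AffineWeylC n) where
  mul_assoc a b c := by
    refine AffineWeylC.ext ?_ (funext fun j => ?_) (funext fun i => ?_)
    · simp [mul_assoc]
    · simp only [mul_s, mul_π, Equiv.Perm.mul_apply]
      rw [mul_assoc]
    · simp only [mul_v, mul_s, mul_π, mul_inv_rev, Equiv.Perm.mul_apply,
        show ∀ (e : Equiv.Perm (Fin n)) (x : Fin n), e (e⁻¹ x) = x from
          fun e x => Equiv.apply_symm_apply e x, Units.val_mul]
      ring
  one_mul a := by
    refine AffineWeylC.ext ?_ (funext fun j => ?_) (funext fun i => ?_) <;>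
      simp
  mul_one a := by
    refine AffineWeylC.ext ?_ (funext fun j => ?_) (funext fun i => ?_) <;>
      simp
  inv_mul_cancel a := by
    refine AffineWeylC.ext ?_ (funext fun j => ?_) (funext fun i => ?_)
    · simp
    · simp
    · simp only [mul_v, inv_v, inv_s, one_v,
        show ∀ (e : Equiv.Perm (Fin n)) (x : Fin n), e (e⁻¹ x) = x from
          fun e x => Equiv.apply_symm_apply e x]
      have h1 : ((a.s (a.π⁻¹ i) : ℤ)) * (((a.s (a.π⁻¹ i))⁻¹ : ℤˣ) : ℤ) = 1 := by
        rw [← Units.val_mul, mul_inv_cancel, Units.val_one]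
      linear_combination (-(a.v i)) * h1

/-- `g` is an involution: a non-identity element squaring to the identity. -/
def Involution (g : AffineWeylC n) : Prop := g ≠ 1 ∧ g * g = 1

/-- The conjugacy class of `a`. -/
def conjClass (a : AffineWeylC n) : Set (AffineWeylC n) := {b | IsConj a b}

/-- The number of transpositions (2-cycles) of the underlying signed permutation. -/
noncomputable def numTrans (g : AffineWeylC n) : ℕ :=
  {i : Fin n | g.π i ≠ i}.ncard / 2

/-- The number of negative 1-cycles of `g` carrying an even label. -/
noncomputable def numNegEven (g : AffineWeylC n) : ℕ :=
  {i : Fin n | g.π i = i ∧ g.s i = -1 ∧ Even (g.v i)}.ncard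

/-- The number of negative 1-cycles of `g` carrying an odd label. -/
noncomputable def numNegOdd (g : AffineWeylC n) : ℕ :=
  {i : Fin n | g.π i = i ∧ g.s i = -1 ∧ Odd (g.v i)}.ncard

/-- The number of positive 1-cycles (fixed points) of `g`. -/
noncomputable def numPos (g : AffineWeylC n) : ℕ :=
  {i : Fin n | g.π i = i ∧ g.s i = 1}.ncard

/-- The labelled cycle type `(m, k_e, k_o, l)` of an involution. -/
noncomputable def cycleType (g : AffineWeylC n) : ℕ × ℕ × ℕ × ℕ :=
  (numTrans g, numNegEven g, numNegOdd g, numPos g)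

/-- `g` has labelled cycle type `(m, k_e, k_o, l)`. -/
def HasType (g : AffineWeylC n) (m ke ko l : ℕ) : Prop :=
  numTrans g = m ∧ numNegEven g = ke ∧ numNegOdd g = ko ∧ numPos g = l

/-- The canonical class representative
`a_{m,k_e,k_o,l} = (1 2)⁺₀ ⋯ (2m−1 2m)⁺₀ (2m+1)⁻₀ ⋯ (2m+k_e)⁻₀
(2m+k_e+1)⁻₁ ⋯ (n−l)⁻₁ (n−l+1)⁺₀ ⋯ (n)⁺₀`
(here written with 0-based indices): points `0,…,2m-1` are paired off into
label‑0 positive transpositions, points `2m,…,2m+k_e-1` are negative 1-cycles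
with label 0, points `2m+k_e,…,2m+k_e+k_o-1` are negative 1-cycles with label 1,
and the remaining `l` points are positive fixed points with label 0. -/
def IsCanon (a : AffineWeylC n) (m ke ko l : ℕ) : Prop :=
  2*m + ke + ko + l = n ∧
  (∀ i : Fin n, i.val < 2*m → i.val % 2 = 0 → (a.π i).val = i.val + 1) ∧
  (∀ i : Fin n, i.val < 2*m → i.val % 2 = 1 → (a.π i).val = i.val - 1) ∧
  (∀ i : Fin n, 2*m ≤ i.val → a.π i = i) ∧
  (∀ i : Fin n, i.val < 2*m → a.s i = 1 ∧ a.v i = 0) ∧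
  (∀ i : Fin n, 2*m ≤ i.val → i.val < 2*m + ke → a.s i = -1 ∧ a.v i = 0) ∧
  (∀ i : Fin n, 2*m + ke ≤ i.val → i.val < 2*m + ke + ko → a.s i = -1 ∧ a.v i = 1) ∧
  (∀ i : Fin n, 2*m + ke + ko ≤ i.val → a.s i = 1 ∧ a.v i = 0)

/-- The labelled positive transposition `(α β)⁺_λ`. -/
def posTrans (α β : Fin n) (lam : ℤ) : AffineWeylC n :=
  ⟨Equiv.swap α β, 1, fun i => if i = α then lam else if i = β then -lam else 0⟩

/-- The labelled negative transposition `(α β)⁻_λ`. -/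
def negTrans (α β : Fin n) (lam : ℤ) : AffineWeylC n :=
  ⟨Equiv.swap α β, fun i => if i = α then -1 else if i = β then -1 else 1,
    fun i => if i = α then lam else if i = β then lam else 0⟩

/-- The labelled negative 1-cycle `(α)⁻_λ`. -/
def negOne (α : Fin n) (lam : ℤ) : AffineWeylC n :=
  ⟨1, fun i => if i = α then -1 else 1, fun i => if i = α then lam else 0⟩

/-- The finite Weyl group Wₙ of type Cₙ, as the subgroup of the affine Weyl
group consisting of the elements with trivial translation part. -/
def WeylSub (n : ℕ) : Subgroup (AffineWeylC n) where
  carrier := {g | g.v = 0}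
  one_mem' := rfl
  mul_mem' := by
    intro g h hg hh
    show (g * h).v = 0
    funext i
    simp only [mul_v]
    rw [show g.v = 0 from hg, show h.v = 0 from hh]
    simp
  inv_mem' := by
    intro g hg
    show g⁻¹.v = 0
    funext i
    simp only [inv_v]
    rw [show g.v = 0 from hg]
    simp

/-- The projection `G_n → W_n`, `(σ, v) ↦ σ`. -/
def weylPart (n : ℕ) : AffineWeylC n →* WeylSub n where
  toFun g := ⟨⟨g.π, g.s, 0⟩, rfl⟩
  map_one' := by
    apply Subtype.ext
    refine AffineWeylC.ext rfl rfl rfl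
  map_mul' g h := by
    apply Subtype.ext
    refine AffineWeylC.ext rfl rfl (funext fun i => ?_)
    simp

end AffineWeylC

/-- The commuting graph on a subset `X` of a group: the vertices are the
elements of `X`, and distinct vertices are adjacent iff they commute. -/
def commGraph {G : Type*} [Group G] (X : Set G) : SimpleGraph X where
  Adj x y := (x : G) ≠ (y : G) ∧ Commute (x : G) (y : G)
  symm := ⟨fun _ _ h => ⟨fun e => h.1 e.symm, h.2.symm⟩⟩
  loopless := ⟨fun _ h => h.1 rfl⟩

namespace AffineWeylC

/-- The element of `G_n` permuting the coordinates by `t`. -/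
def permElt {n : ℕ} (t : Equiv.Perm (Fin n)) : AffineWeylC n := ⟨t, 1, 0⟩

lemma permElt_mul {n : ℕ} (t u : Equiv.Perm (Fin n)) :
    permElt (t * u) = permElt u * permElt t :=
  AffineWeylC.ext rfl (funext fun _ => by simp [permElt]) (funext fun _ => by simp [permElt])

/-- The involution `(0 1)^ε_lam (2)⁻_{2p} (3)⁻_{2q} (4)⁺_0` of `G_5`. -/
def stdInv (ε : ℤˣ) (lam p q : ℤ) : AffineWeylC 5 :=
  ⟨Equiv.swap 0 1, ![ε, ε, -1, -1, 1], ![lam, -ε * lam, 2 * p, 2 * q, 0]⟩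

/-- `stdInv` with its coordinates reindexed by `t`. -/
def reindex (t : Equiv.Perm (Fin 5)) (ε : ℤˣ) (lam p q : ℤ) : AffineWeylC 5 :=
  (permElt t)⁻¹ * stdInv ε lam p q * permElt t

lemma reindex_π (t : Equiv.Perm (Fin 5)) (ε : ℤˣ) (lam p q : ℤ) :
    (reindex t ε lam p q).π = t * Equiv.swap 0 1 * t⁻¹ := by
  simp [reindex, permElt, stdInv, mul_assoc]

lemma reindex_s (t : Equiv.Perm (Fin 5)) (ε : ℤˣ) (lam p q : ℤ) (i : Fin 5) :
    (reindex t ε lam p q).s i = (![ε, ε, -1, -1, 1] : Fin 5 → ℤˣ) (t⁻¹ i) := by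
  simp [reindex, permElt, stdInv]

lemma reindex_v (t : Equiv.Perm (Fin 5)) (ε : ℤˣ) (lam p q : ℤ) (i : Fin 5) :
    (reindex t ε lam p q).v i
      = (![lam, -ε * lam, 2 * p, 2 * q, 0] : Fin 5 → ℤ) (t⁻¹ i) := by
  simp [reindex, permElt, stdInv]

lemma reindex_mul (t u : Equiv.Perm (Fin 5)) (ε : ℤˣ) (lam p q : ℤ) :
    reindex (t * u) ε lam p q = (permElt t)⁻¹ * reindex u ε lam p q * permElt t := by
  simp only [reindex, permElt_mul]
  group

lemma commute_reindex_mul_iff (t u : Equiv.Perm (Fin 5)) (ε ε' : ℤˣ)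
    (lam p q lam' p' q' : ℤ) :
    Commute (reindex t ε lam p q) (reindex (t * u) ε' lam' p' q')
      ↔ Commute (stdInv ε lam p q) (reindex u ε' lam' p' q') := by
  rw [reindex_mul, reindex]
  simpa using Commute.conj_iff (a := stdInv ε lam p q) (b := reindex u ε' lam' p' q')
    (permElt t)⁻¹

lemma commute_of_forall {g h : AffineWeylC 5} (hπ : g.π * h.π = h.π * g.π)
    (hs : ∀ i, (g * h).s i = (h * g).s i) (hv : ∀ i, (g * h).v i = (h * g).v i) :
    Commute g h :=
  AffineWeylC.ext hπ.symm (funext hs) (funext hv)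

/-- Reflections in orthogonal directions on the transposed pair commute, and one of the two
negative 1-cycles may be moved to the free coordinate. -/
lemma commute_reindex_swap (t : Equiv.Perm (Fin 5)) (ε ε' : ℤˣ) (lam lam' p q q' : ℤ)
    (h : ε' = -ε ∨ ε' = ε ∧ lam' = lam) :
    Commute (reindex t ε lam p q) (reindex (t * Equiv.swap 3 4) ε' lam' p q') := by
  rw [commute_reindex_mul_iff]
  refine commute_of_forall (by simp only [reindex_π, stdInv]; decide) ?_ ?_ <;>
    intro i <;> rcases Int.units_eq_one_or ε with rfl | rfl <;>
    rcases h with rfl | ⟨rfl, rfl⟩ <;> fin_cases i <;>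
    simp [reindex_s, reindex_π, reindex_v, stdInv, Equiv.swap_apply_def, add_comm]

lemma reindex_mul_swap_two_three (t : Equiv.Perm (Fin 5)) (ε : ℤˣ) (lam p q : ℤ) :
    reindex (t * Equiv.swap 2 3) ε lam p q = reindex t ε lam q p := by
  have h : reindex (Equiv.swap 2 3) ε lam p q = stdInv ε lam q p := by
    refine AffineWeylC.ext (by simp only [reindex_π, stdInv]; decide) (funext fun i => ?_)
      (funext fun i => ?_) <;> fin_cases i <;>
      simp [reindex_s, reindex_v, stdInv, Equiv.swap_apply_def]
  rw [reindex_mul, h, reindex]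

/-- Two commuting involutions whose pairs of negative 1-cycles and transposed coordinates are
interchanged: each centre lies on the reflecting hyperplane of the other transposition. -/
lemma commute_reindex_cross (t : Equiv.Perm (Fin 5)) (ε ε' : ℤˣ) (lam lam' p q r s : ℤ)
    (h : r - ε * s = lam) (h' : p - ε' * q = lam') :
    Commute (reindex t ε lam p q)
      (reindex (t * (Equiv.swap 0 2 * Equiv.swap 1 3)) ε' lam' r s) := by
  rw [commute_reindex_mul_iff]
  subst h h'
  refine commute_of_forall (by simp only [reindex_π, stdInv]; decide) ?_ ?_ <;>
    intro i <;> rcases Int.units_eq_one_or ε with rfl | rfl <;>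
    rcases Int.units_eq_one_or ε' with rfl | rfl <;> fin_cases i <;>
    simp [reindex_s, reindex_π, reindex_v, stdInv, Equiv.swap_apply_def] <;> ring

lemma perm_mem_of_le_one : ∀ σ : Equiv.Perm (Fin 5), σ 0 ≤ 1 → σ 1 ≤ 1 →
    σ ∈ ([1, Equiv.swap 2 3, Equiv.swap 2 4, Equiv.swap 3 4,
      Equiv.swap 2 3 * Equiv.swap 3 4, Equiv.swap 3 4 * Equiv.swap 2 3,
      Equiv.swap 0 1, Equiv.swap 0 1 * Equiv.swap 2 3, Equiv.swap 0 1 * Equiv.swap 2 4,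
      Equiv.swap 0 1 * Equiv.swap 3 4, Equiv.swap 0 1 * (Equiv.swap 2 3 * Equiv.swap 3 4),
      Equiv.swap 0 1 * (Equiv.swap 3 4 * Equiv.swap 2 3)] : List (Equiv.Perm (Fin 5))) := by
  set_option maxRecDepth 100000 in
  decide

lemma exists_commute_reindex_mul (t σ : Equiv.Perm (Fin 5)) (h0 : σ 0 ≤ 1) (h1 : σ 1 ≤ 1)
    (ε : ℤˣ) (lam p q : ℤ) :
    ∃ ε' lam' p' q', Commute (reindex t ε lam p q) (reindex (t * σ) ε' lam' p' q') := by
  refine ⟨ε, if σ 0 = 0 then lam else -ε * lam, (![0, 0, p, q, 0] : Fin 5 → ℤ) (σ 2),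
    (![0, 0, p, q, 0] : Fin 5 → ℤ) (σ 3), ?_⟩
  rw [commute_reindex_mul_iff]
  have := perm_mem_of_le_one σ h0 h1
  clear h0 h1
  simp only [List.mem_cons, List.not_mem_nil, or_false] at this
  rcases this with rfl | rfl | rfl | rfl | rfl | rfl | rfl | rfl | rfl | rfl | rfl | rfl <;>
  refine commute_of_forall (by simp only [reindex_π, stdInv]; decide) ?_ ?_ <;>
    intro i <;> rcases Int.units_eq_one_or ε with rfl | rfl <;> fin_cases i <;>
    simp [reindex_s, reindex_π, reindex_v, stdInv, Equiv.swap_apply_def]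

/-- All reindexed standard involutions. -/
def reindexed : Set (AffineWeylC 5) := {x | ∃ t ε lam p q, reindex t ε lam p q = x}

lemma reindex_mem (t : Equiv.Perm (Fin 5)) (ε : ℤˣ) (lam p q : ℤ) :
    reindex t ε lam p q ∈ reindexed := ⟨t, ε, lam, p, q, rfl⟩

lemma exists_chain_self (t : Equiv.Perm (Fin 5)) (ε ε' : ℤˣ) (lam p q lam' p' q' : ℤ) :
    ∃ y ∈ reindexed, ∃ z ∈ reindexed, Commute (reindex t ε lam p q) y ∧ Commute y z ∧
      Commute z (reindex t ε' lam' p' q') := by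
  obtain ⟨η, μ, hη, hη'⟩ : ∃ (η : ℤˣ) (μ : ℤ), (η = -ε ∨ η = ε ∧ μ = lam) ∧
      (ε' = -η ∨ ε' = η ∧ lam' = μ) := by
    rcases Int.units_eq_one_or ε with rfl | rfl <;>
    rcases Int.units_eq_one_or ε' with rfl | rfl
    · exact ⟨-1, 0, by simp⟩
    · exact ⟨1, lam, by simp⟩
    · exact ⟨-1, lam, by simp⟩
    · exact ⟨1, 0, by simp⟩
  refine ⟨_, reindex_mem _ _ _ _ _, reindex
      (t * Equiv.swap 3 4 * Equiv.swap 2 3 * Equiv.swap 3 4 * Equiv.swap 2 3) η μ q' 0,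
    reindex_mem _ _ _ _ _, commute_reindex_swap t ε η lam μ p q 0 hη, ?_, ?_⟩
  · rw [reindex_mul_swap_two_three, ← reindex_mul_swap_two_three (t * Equiv.swap 3 4)]
    exact commute_reindex_swap _ _ _ _ _ _ _ _ (Or.inr ⟨rfl, rfl⟩)
  · convert commute_reindex_swap _ η ε' μ lam' q' 0 p' hη' using 1
    rw [← reindex_mul_swap_two_three]
    congr 1
    simp only [mul_assoc]
    rw [mul_right_inj]
    decide

lemma exists_chain_cross (t : Equiv.Perm (Fin 5)) (ε ε' : ℤˣ) (lam p q lam' p' q' : ℤ) :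
    ∃ y ∈ reindexed, ∃ z ∈ reindexed, Commute (reindex t ε lam p q) y ∧ Commute y z ∧
      Commute z (reindex (t * (Equiv.swap 0 2 * Equiv.swap 1 3)) ε' lam' p' q') := by
  refine ⟨_, reindex_mem _ _ _ _ _, _, reindex_mem _ _ _ _ _,
    commute_reindex_cross t ε (-ε') lam (p - (-ε' : ℤˣ) * q) p q p' (ε * (p' - lam)) ?_ rfl,
    commute_reindex_swap _ _ ε' _ lam' _ _ 0 (Or.inl (neg_neg _).symm), ?_⟩
  · rcases Int.units_eq_one_or ε with rfl | rfl <;> simp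
  · convert commute_reindex_swap _ ε' ε' lam' lam' p' 0 q' (Or.inr ⟨rfl, rfl⟩) using 2
    rw [mul_assoc _ (Equiv.swap (3 : Fin 5) 4), Equiv.swap_mul_self, mul_one]

lemma exists_chain_overlap (t : Equiv.Perm (Fin 5)) (ε ε' : ℤˣ) (lam p q lam' p' q' : ℤ) :
    ∃ y ∈ reindexed, ∃ z ∈ reindexed, Commute (reindex t ε lam p q) y ∧ Commute y z ∧
      Commute z (reindex (t * Equiv.swap 1 4) ε' lam' p' q') := by
  refine ⟨_, reindex_mem _ _ _ _ _, _, reindex_mem _ _ _ _ _,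
    commute_reindex_cross t ε 1 lam (p - q) p q 0 (-ε * lam) ?_ (by simp), ?_,
    (commute_reindex_cross (t * Equiv.swap 1 4) ε' (-1) lam' (p' + q') p' q' 0 (-ε' * lam') ?_
      (by simp)).symm⟩
  · rcases Int.units_eq_one_or ε with rfl | rfl <;> simp
  · convert commute_reindex_swap _ 1 (-1) _ (p' + q') 0 _ (-ε' * lam') (Or.inl rfl) using 2
    simp only [mul_assoc]
    rw [mul_right_inj]
    decide
  · rcases Int.units_eq_one_or ε' with rfl | rfl <;> simp

lemma exists_perm_factor : ∀ a b : Fin 5, a ≠ b →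
    ∃ ρ ∈ ([1, Equiv.swap 2 4, Equiv.swap 3 4, Equiv.swap 0 1, Equiv.swap 0 1 * Equiv.swap 2 4,
      Equiv.swap 0 1 * Equiv.swap 3 4] : List (Equiv.Perm (Fin 5))),
    ∃ κ ∈ ([1, Equiv.swap 0 2 * Equiv.swap 1 3, Equiv.swap 1 4] : List (Equiv.Perm (Fin 5))),
      ρ 0 ≤ 1 ∧ ρ 1 ≤ 1 ∧ (ρ * κ)⁻¹ a ≤ 1 ∧ (ρ * κ)⁻¹ b ≤ 1 := by
  set_option maxRecDepth 100000 in
  decide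

lemma inv_le_one : ∀ σ : Equiv.Perm (Fin 5), σ 0 ≤ 1 → σ 1 ≤ 1 → σ⁻¹ 0 ≤ 1 ∧ σ⁻¹ 1 ≤ 1 := by
  set_option maxRecDepth 100000 in
  decide

lemma exists_chain {x y : AffineWeylC 5} (hx : x ∈ reindexed) (hy : y ∈ reindexed) :
    ∃ c₁ ∈ reindexed, ∃ c₂ ∈ reindexed, ∃ c₃ ∈ reindexed, ∃ c₄ ∈ reindexed,
      Commute x c₁ ∧ Commute c₁ c₂ ∧ Commute c₂ c₃ ∧ Commute c₃ c₄ ∧ Commute c₄ y := by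
  obtain ⟨t, ε, lam, p, q, rfl⟩ := hx
  obtain ⟨t', ε', lam', p', q', rfl⟩ := hy
  obtain ⟨ρ, -, κ, hκ, h0, h1, h0', h1'⟩ := exists_perm_factor ((t⁻¹ * t') 0) ((t⁻¹ * t') 1)
    (by simp)
  rw [← Equiv.Perm.mul_apply] at h0' h1'
  obtain ⟨h0', h1'⟩ := inv_le_one _ h0' h1'
  obtain ⟨ε₁, lam₁, p₁, q₁, hc₁⟩ := exists_commute_reindex_mul t ρ h0 h1 ε lam p q
  obtain ⟨ε₂, lam₂, p₂, q₂, hc₂⟩ := exists_commute_reindex_mul t' _ h0' h1' ε' lam' p' q'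
  rw [show t' * ((ρ * κ)⁻¹ * (t⁻¹ * t'))⁻¹ = t * ρ * κ by group] at hc₂
  have key : ∃ y ∈ reindexed, ∃ z ∈ reindexed, Commute (reindex (t * ρ) ε₁ lam₁ p₁ q₁) y ∧
      Commute y z ∧ Commute z (reindex (t * ρ * κ) ε₂ lam₂ p₂ q₂) := by
    simp only [List.mem_cons, List.not_mem_nil, or_false] at hκ
    rcases hκ with rfl | rfl | rfl
    · simpa using exists_chain_self (t * ρ) ε₁ ε₂ lam₁ p₁ q₁ lam₂ p₂ q₂
    · exact exists_chain_cross (t * ρ) ε₁ ε₂ lam₁ p₁ q₁ lam₂ p₂ q₂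
    · exact exists_chain_overlap (t * ρ) ε₁ ε₂ lam₁ p₁ q₁ lam₂ p₂ q₂
  obtain ⟨y, hy, z, hz, h₁, h₂, h₃⟩ := key
  exact ⟨_, reindex_mem _ _ _ _ _, y, hy, z, hz, _, reindex_mem _ _ _ _ _,
    hc₁, h₁, h₂, h₃, hc₂.symm⟩

lemma isConj_reindex (t : Equiv.Perm (Fin 5)) (ε : ℤˣ) (lam p q : ℤ) :
    IsConj (stdInv 1 0 0 0) (reindex t ε lam p q) := by
  have h : IsConj (stdInv 1 0 0 0) (stdInv ε lam p q) := by
    rw [isConj_iff]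
    refine ⟨⟨1, ![1, ε, 1, 1, 1], ![0, lam, -p, -q, 0]⟩, ?_⟩
    rw [mul_inv_eq_iff_eq_mul]
    refine AffineWeylC.ext rfl (funext fun i => ?_) (funext fun i => ?_) <;>
      rcases Int.units_eq_one_or ε with rfl | rfl <;> fin_cases i <;>
      simp [stdInv, Equiv.swap_apply_def, two_mul]
  exact h.trans (isConj_iff.2 ⟨(permElt t)⁻¹, by rw [inv_inv, reindex]⟩)

lemma mem_reindexed_of_isConj {x : AffineWeylC 5} (h : IsConj (stdInv 1 0 0 0) x) :
    x ∈ reindexed := by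
  obtain ⟨⟨π, s, u⟩, rfl⟩ := isConj_iff.1 h
  refine ⟨π⁻¹, s (π⁻¹ 0) * s (π⁻¹ 1), s (π⁻¹ 0) * (u 1 - u 0), -s (π⁻¹ 2) * u 2,
    -s (π⁻¹ 3) * u 3, ?_⟩
  rw [eq_mul_inv_iff_mul_eq]
  refine AffineWeylC.ext ?_ (funext fun i => ?_) (funext fun i => ?_)
  · simp [reindex_π, stdInv, mul_assoc]
  · obtain ⟨j, rfl⟩ := π⁻¹.surjective i
    have h : ∀ x y : ℤˣ, x * (y * x) = y := by decide
    fin_cases j <;> simp [reindex_s, reindex_π, stdInv, mul_assoc, Equiv.swap_apply_def, h]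
  · have h0 := Int.units_coe_mul_self (s (π.symm 0))
    have h1 := Int.units_coe_mul_self (s (π.symm 1))
    have h2 := Int.units_coe_mul_self (s (π.symm 2))
    have h3 := Int.units_coe_mul_self (s (π.symm 3))
    fin_cases i <;> simp [reindex_v, stdInv, Equiv.swap_apply_def]
    · linear_combination (u 1 - u 0) * h0
    · linear_combination -(u 1 - u 0) * s (π.symm 1) ^ 2 * h0 - (u 1 - u 0) * h1
    · linear_combination -2 * u 2 * h2
    · linear_combination -2 * u 3 * h3

lemma exists_fin_five_perm : ∀ c d e : Fin 5, c ≠ d → c ≠ e → d ≠ e →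
    ∃ t : Equiv.Perm (Fin 5), t 2 = c ∧ t 3 = d ∧ t 4 = e := by
  set_option maxRecDepth 100000 in
  decide

lemma fin_five_eq_of_fixed : ∀ σ : Equiv.Perm (Fin 5), σ 2 = 2 → σ 3 = 3 → σ 4 = 4 → σ 0 ≠ 0 →
    σ = Equiv.swap 0 1 := by
  set_option maxRecDepth 100000 in
  decide

lemma mem_reindexed_of_hasType {a : AffineWeylC 5} (ha : a.Involution)
    (htype : a.HasType 1 2 0 1) : a ∈ reindexed := by
  obtain ⟨-, hke, hko, hl⟩ := htype
  obtain ⟨e, he⟩ := Set.ncard_eq_one.1 hl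
  obtain ⟨c, d, hcd, hc⟩ := Set.ncard_eq_two.1 hke
  have he1 : a.π e = e ∧ a.s e = 1 := by
    have : e ∈ ({e} : Set (Fin 5)) := rfl
    rwa [← he] at this
  have hc1 : a.π c = c ∧ a.s c = -1 ∧ Even (a.v c) := by
    have : c ∈ ({c, d} : Set (Fin 5)) := by simp
    rwa [← hc] at this
  have hd1 : a.π d = d ∧ a.s d = -1 ∧ Even (a.v d) := by
    have : d ∈ ({c, d} : Set (Fin 5)) := by simp
    rwa [← hc] at this
  have hce : c ≠ e := by
    rintro rfl
    have := he1.2.symm.trans hc1.2.1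
    exact absurd this (by decide)
  have hde : d ≠ e := by
    rintro rfl
    have := he1.2.symm.trans hd1.2.1
    exact absurd this (by decide)
  have hfix : ∀ i, a.π i = i → i = c ∨ i = d ∨ i = e := by
    intro i hi
    rcases Int.units_eq_one_or (a.s i) with hs | hs
    · have : i ∈ ({e} : Set (Fin 5)) := by rw [← he]; exact ⟨hi, hs⟩
      exact Or.inr (Or.inr this)
    · rcases Int.even_or_odd (a.v i) with hv | hv
      · have : i ∈ ({c, d} : Set (Fin 5)) := by rw [← hc]; exact ⟨hi, hs, hv⟩
        rcases this with h | h
        · exact Or.inl h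
        · exact Or.inr (Or.inl h)
      · have h0 := (Set.ncard_eq_zero (Set.toFinite _)).1 hko
        have : i ∈ (∅ : Set (Fin 5)) := by rw [← h0]; exact ⟨hi, hs, hv⟩
        exact this.elim
  obtain ⟨t, rfl, rfl, rfl⟩ := exists_fin_five_perm c d e hcd hce hde
  have hπ : a.π = t * Equiv.swap 0 1 * t⁻¹ := by
    have := fin_five_eq_of_fixed (t⁻¹ * a.π * t) (by simp [hc1.1]) (by simp [hd1.1])
      (by simp [he1.1]) (fun h => by
        have h' : a.π (t 0) = t 0 := by
          simpa [Equiv.symm_apply_eq] using h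
        simpa using hfix _ h')
    rw [← this]
    group
  have h01 : a.π (t 0) = t 1 := by simp [hπ]
  have hi0 : a.π⁻¹ (t 0) = t 1 := by simp [hπ]
  have hi4 : a.π⁻¹ (t 4) = t 4 := by simp [hπ, Equiv.swap_apply_def]
  have hs : a.s (t 1) = a.s (t 0) := by
    have := congrArg (fun g => g.s (t 0)) ha.2
    simp only [mul_s, h01, one_s] at this
    rw [← inv_eq_of_mul_eq_one_right this, Int.units_inv_eq_self]
  have hv0 : a.s (t 0) * a.v (t 1) + a.v (t 0) = 0 := by
    have := congrArg (fun g => g.v (t 0)) ha.2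
    simpa only [mul_v, hi0, one_v, hs] using this
  have hv4 : a.v (t 4) = 0 := by
    have := congrArg (fun g => g.v (t 4)) ha.2
    simp only [mul_v, hi4, one_v, he1.2, Units.val_one] at this
    linarith
  obtain ⟨p, hp⟩ := hc1.2.2
  obtain ⟨q, hq⟩ := hd1.2.2
  refine ⟨t, a.s (t 0), a.v (t 0), p, q, AffineWeylC.ext ?_ (funext fun i => ?_)
    (funext fun i => ?_)⟩
  · rw [reindex_π, hπ]
  · obtain ⟨j, rfl⟩ := t.surjective i
    fin_cases j <;> simp [reindex_s, hs, hc1.2.1, hd1.2.1, he1.2]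
  · obtain ⟨j, rfl⟩ := t.surjective i
    have := Int.units_coe_mul_self (a.s (t 0))
    fin_cases j <;> simp [reindex_v, hp, hq, hv4, two_mul]
    linear_combination (-(a.s (t 0) : ℤ)) * hv0 + a.v (t 1) * this

lemma conjClass_eq_reindexed {a : AffineWeylC 5} (ha : a.Involution)
    (htype : a.HasType 1 2 0 1) : conjClass a = reindexed := by
  obtain ⟨t, ε, lam, p, q, rfl⟩ := mem_reindexed_of_hasType ha htype
  have h := isConj_reindex t ε lam p q
  ext x
  constructor
  · intro hx
    exact mem_reindexed_of_isConj (h.trans hx)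
  · rintro ⟨t', ε', lam', p', q', rfl⟩
    exact h.symm.trans (isConj_reindex t' ε' lam' p' q')

lemma stdInv_π_s_commute : ∀ (σ : Equiv.Perm (Fin 5)) (ε ε' : ℤˣ),
    Equiv.swap 0 1 * (σ * Equiv.swap 0 1 * σ⁻¹) = σ * Equiv.swap 0 1 * σ⁻¹ * Equiv.swap 0 1 →
    (∀ i, (![ε, ε, -1, -1, 1] : Fin 5 → ℤˣ) i *
        (![ε', ε', -1, -1, 1] : Fin 5 → ℤˣ) (σ⁻¹ (Equiv.swap 0 1 i)) =
      (![ε', ε', -1, -1, 1] : Fin 5 → ℤˣ) (σ⁻¹ i) *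
        (![ε, ε, -1, -1, 1] : Fin 5 → ℤˣ)
          ((σ * Equiv.swap 0 1 * σ⁻¹ : Equiv.Perm (Fin 5)) i)) →
    (σ 0 ≤ 1 ∧ σ 1 ≤ 1) ∨ (σ 4 = 4 ∧ (σ 0 = 2 ∧ σ 1 = 3 ∨ σ 0 = 3 ∧ σ 1 = 2)) := by
  set_option maxRecDepth 100000 in
  decide

lemma stdInv_π_s_eq : ∀ (σ : Equiv.Perm (Fin 5)) (ε ε' : ℤˣ),
    Equiv.swap 0 1 = σ * Equiv.swap 0 1 * σ⁻¹ →
    (∀ i, (![ε, ε, -1, -1, 1] : Fin 5 → ℤˣ) i =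
      (![ε', ε', -1, -1, 1] : Fin 5 → ℤˣ) (σ⁻¹ i)) →
    (σ 0 ≤ 1 ∧ σ 1 ≤ 1) ∧ σ 4 = 4 := by
  set_option maxRecDepth 100000 in
  decide

lemma of_commute_stdInv {σ : Equiv.Perm (Fin 5)} {ε ε' : ℤˣ} {lam p q lam' p' q' : ℤ}
    (h : Commute (stdInv ε lam p q) (reindex σ ε' lam' p' q')) :
    (σ 0 ≤ 1 ∧ σ 1 ≤ 1) ∨ (σ 4 = 4 ∧ (σ 0 = 2 ∧ σ 1 = 3 ∨ σ 0 = 3 ∧ σ 1 = 2)) := by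
  refine stdInv_π_s_commute σ ε ε' ?_ fun i => ?_
  · have := congrArg π h.eq
    rw [mul_π, mul_π, reindex_π] at this
    exact this.symm
  · have := congrArg (fun g => g.s i) h.eq
    simp only [mul_s, reindex_s, reindex_π] at this
    exact this

lemma of_stdInv_eq {σ : Equiv.Perm (Fin 5)} {ε ε' : ℤˣ} {lam p q lam' p' q' : ℤ}
    (h : stdInv ε lam p q = reindex σ ε' lam' p' q') :
    (σ 0 ≤ 1 ∧ σ 1 ≤ 1) ∧ σ 4 = 4 := by
  refine stdInv_π_s_eq σ ε ε' ?_ fun i => ?_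
  · have := congrArg π h
    rwa [reindex_π] at this
  · have := congrArg (fun g => g.s i) h
    simp only [reindex_s] at this
    exact this

/-- The distance, in the quotient graph recording only the transposed pair and the free
coordinate, from the state with pair `{0, 1}` and free coordinate `4` to the state with
pair `{a, b}` and free coordinate `e`. -/
def height (a b e : Fin 5) : ℕ :=
  if a ≤ 1 ∧ b ≤ 1 then (if e = 4 then 0 else 1)
  else if 2 ≤ a ∧ 2 ≤ b then
    (if a ≠ 4 ∧ b ≠ 4 then (if e = 4 then 1 else 2) else (if 2 ≤ e then 2 else 3))
  else if a = 4 ∨ b = 4 then (if e ≤ 1 then 3 else 4)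
  else (if e ≤ 1 then 4 else 5)

lemma height_comm : ∀ a b e : Fin 5, height a b e = height b a e := by decide

lemma height_le_of_same_pair : ∀ a b : Fin 5, a ≠ b → ∀ e : Fin 5, e ≠ a → e ≠ b →
    ∀ e' : Fin 5, e' ≠ a → e' ≠ b → height a b e' ≤ height a b e + 1 := by
  set_option maxRecDepth 100000 in
  decide

lemma height_le_of_disjoint_pair : ∀ t : Equiv.Perm (Fin 5),
    height (t 2) (t 3) (t 4) ≤ height (t 0) (t 1) (t 4) + 1 := by
  set_option maxRecDepth 100000 in
  decide

lemma perm_zero_one_cases : ∀ σ : Equiv.Perm (Fin 5), σ 0 ≤ 1 → σ 1 ≤ 1 →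
    (σ 0 = 0 ∧ σ 1 = 1 ∨ σ 0 = 1 ∧ σ 1 = 0) ∧ σ 4 ≠ 0 ∧ σ 4 ≠ 1 := by
  set_option maxRecDepth 100000 in
  decide

/-- The height of a reindexed standard involution. -/
def permHeight (t : Equiv.Perm (Fin 5)) : ℕ := height (t 0) (t 1) (t 4)

lemma permHeight_le_of_commute {t t' : Equiv.Perm (Fin 5)} {ε ε' : ℤˣ}
    {lam p q lam' p' q' : ℤ} (h : Commute (reindex t ε lam p q) (reindex t' ε' lam' p' q')) :
    permHeight t' ≤ permHeight t + 1 := by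
  obtain ⟨σ, rfl⟩ : ∃ σ, t' = t * σ := ⟨t⁻¹ * t', by group⟩
  rw [commute_reindex_mul_iff] at h
  simp only [permHeight, Equiv.Perm.mul_apply]
  rcases of_commute_stdInv h with ⟨h0, h1⟩ | ⟨h4, ⟨h0, h1⟩ | ⟨h0, h1⟩⟩
  · obtain ⟨⟨h0, h1⟩ | ⟨h0, h1⟩, h40, h41⟩ := perm_zero_one_cases σ h0 h1
    · rw [h0, h1]
      apply height_le_of_same_pair <;> simp_all
    · rw [h0, h1, height_comm]
      apply height_le_of_same_pair <;> simp_all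
  · rw [h0, h1, h4]
    exact height_le_of_disjoint_pair t
  · rw [h0, h1, h4, height_comm]
    exact height_le_of_disjoint_pair t

lemma permHeight_eq_of_eq {t t' : Equiv.Perm (Fin 5)} {ε ε' : ℤˣ}
    {lam p q lam' p' q' : ℤ} (h : reindex t ε lam p q = reindex t' ε' lam' p' q') :
    permHeight t = permHeight t' := by
  obtain ⟨σ, rfl⟩ : ∃ σ, t' = t * σ := ⟨t⁻¹ * t', by group⟩
  rw [reindex_mul, reindex] at h
  have h := mul_left_cancel (mul_right_cancel h)
  obtain ⟨⟨h0, h1⟩, h4⟩ := of_stdInv_eq h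
  simp only [permHeight, Equiv.Perm.mul_apply]
  obtain ⟨⟨h0, h1⟩ | ⟨h0, h1⟩, -, -⟩ := perm_zero_one_cases σ h0 h1
  · rw [h0, h1, h4]
  · rw [h0, h1, h4, height_comm]

lemma permHeight_le_add_length {x y : reindexed} (w : (commGraph reindexed).Walk x y)
    {t t' : Equiv.Perm (Fin 5)} {ε ε' : ℤˣ} {lam p q lam' p' q' : ℤ}
    (hx : reindex t ε lam p q = x) (hy : reindex t' ε' lam' p' q' = y) :
    permHeight t' ≤ permHeight t + w.length := by
  induction w generalizing t ε lam p q with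
  | nil => simp [permHeight_eq_of_eq (hx.trans hy.symm)]
  | cons hadj w ih =>
    rename_i u v z
    obtain ⟨t₁, ε₁, lam₁, p₁, q₁, hv⟩ := v.2
    have h1 := ih hv hy
    have h2 := hadj.2
    rw [← hx, ← hv] at h2
    have h3 := permHeight_le_of_commute h2
    rw [SimpleGraph.Walk.length_cons]
    omega

end AffineWeylC

lemma edist_commGraph_le_one {G : Type*} [Group G] {X : Set G} {x y : X}
    (h : Commute (x : G) (y : G)) : (commGraph X).edist x y ≤ 1 := by
  by_cases hxy : x = y
  · simp [hxy]
  · have hadj : (commGraph X).Adj x y := ⟨fun e => hxy (Subtype.ext e), h⟩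
    exact (SimpleGraph.edist_eq_one_iff_adj.2 hadj).le

open AffineWeylC in
lemma edist_reindexed_le (x y : reindexed) : (commGraph reindexed).edist x y ≤ 5 := by
  obtain ⟨c₁, m₁, c₂, m₂, c₃, m₃, c₄, m₄, h₁, h₂, h₃, h₄, h₅⟩ := exists_chain x.2 y.2
  have h₁ := edist_commGraph_le_one (x := x) (y := ⟨c₁, m₁⟩) h₁
  have h₂ := edist_commGraph_le_one (x := ⟨c₁, m₁⟩) (y := ⟨c₂, m₂⟩) h₂
  have h₃ := edist_commGraph_le_one (x := ⟨c₂, m₂⟩) (y := ⟨c₃, m₃⟩) h₃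
  have h₄ := edist_commGraph_le_one (x := ⟨c₃, m₃⟩) (y := ⟨c₄, m₄⟩) h₄
  have h₅ := edist_commGraph_le_one (x := ⟨c₄, m₄⟩) (y := y) h₅
  have t {u v w : reindexed} {m : ℕ∞} (h : (commGraph reindexed).edist u v ≤ m)
      (h' : (commGraph reindexed).edist v w ≤ 1) : (commGraph reindexed).edist u w ≤ m + 1 :=
    SimpleGraph.edist_triangle.trans (add_le_add h h')
  exact (t (t (t (t h₁ h₂) h₃) h₄) h₅).trans (by norm_num)

/-- For the class of labelled cycle type `(1, 2, 0, 1)` in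
`G₅`, the commuting involution graph is connected with diameter exactly 5. -/
theorem stmt_16 (a : AffineWeylC 5) (ha : a.Involution)
    (htype : a.HasType 1 2 0 1)
    (X : Set (AffineWeylC 5)) (hX : X = AffineWeylC.conjClass a) :
    (commGraph X).Connected ∧ (commGraph X).ediam = 5 := by
  rw [AffineWeylC.conjClass_eq_reindexed ha htype] at hX
  subst hX
  let x : AffineWeylC.reindexed := ⟨_, AffineWeylC.reindex_mem 1 1 0 0 0⟩
  let y : AffineWeylC.reindexed := ⟨_, AffineWeylC.reindex_mem (Equiv.swap 1 2) 1 0 0 0⟩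
  refine ⟨{ preconnected := fun u v => ?_, nonempty := ⟨x⟩ }, le_antisymm ?_ ?_⟩
  · rw [← SimpleGraph.edist_ne_top_iff_reachable]
    exact ((edist_reindexed_le u v).trans_lt (by decide)).ne
  · exact SimpleGraph.ediam_le_of_edist_le edist_reindexed_le
  · refine le_trans ?_ (SimpleGraph.edist_le_ediam (u := x) (v := y))
    refine le_iInf fun w => ?_
    have h := AffineWeylC.permHeight_le_add_length w rfl rfl
    rw [show AffineWeylC.permHeight 1 = 0 by decide,
      show AffineWeylC.permHeight (Equiv.swap 1 2) = 5 by decide, zero_add] at h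
    exact_mod_cast h
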